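/- Let L ⊆ k̄² be a line defined over 𝔽_q (the zero set of an equation ax + by = c with a, b, c ∈ 𝔽_q and (a,b) ≠ (0,0)). For n > 0, the number of n-element subsets S ⊆ k̄² \ L with σ(S) = S equals ((q² − 1)/(q² + q + 1)) · (q^{2n} − q^{n/2}) if n is even, and ((q − 1)/(q² + q + 1)) · ((q + 1)q^{2n} + q^{(n+1)/2}) if n is odd. -/

import Mathlib

/-- The `q`-power Frobenius acting coordinatewise on `k̄^N`,
where `q = |k|`. -/
noncomputable def afFrob (k : Type*) [Field k] [Fintype k] (N : ℕ) :
    (Fin N → AlgebraicClosure k) → (Fin N → AlgebraicClosure k) :=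
  fun v i => (v i) ^ (Fintype.card k)

/-- The number of `n`-element subsets `S` of `A ⊆ X` with `σ(S) = S`. -/
noncomputable def nSetCount {X : Type*} (σ : X → X) (A : Set X) (n : ℕ) : ℕ :=
  Set.ncard {S : Set X | S ⊆ A ∧ S.Finite ∧ S.ncard = n ∧ σ '' S = S}

open Finset PowerSeries in
/-- algebra: the recurrence determines the series -/
theorem algA (q : ℚ) (A1 A2 B1 B2 R : PowerSeries ℚ)
  (h1 : A1 * (1 - C q * X) = 1) (h2 : A2 * (1 - C (q^2) * X) = 1)
  (h3 : B1 * (1 - C q * X^2) = 1) (h4 : B2 * (1 - C (q^2) * X^2) = 1)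
  (hR : R * ((1 - C (q^2) * X) * (1 - C q * X^2)) = (1 - C q * X) * (1 - C (q^2) * X^2)) :
  X * derivative ℚ R = R * (A2 - A1 - 2 * (B2 - B1)) := by
  have hd := congrArg (derivative ℚ) hR
  simp only [Derivation.leibniz, map_sub, smul_eq_mul, derivative_C, derivative_X, pow_two, Derivation.map_one_eq_zero] at hd
  have e1 : (1 - C q * X : PowerSeries ℚ) ≠ 0 := by
    rintro h; simp [h] at h1
  have e2 : (1 - C (q^2) * X : PowerSeries ℚ) ≠ 0 := by
    rintro h; rw [h, mul_zero] at h2; exact zero_ne_one h2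
  have e3 : (1 - C q * X^2 : PowerSeries ℚ) ≠ 0 := by
    rintro h; simp [h] at h3
  have e4 : (1 - C (q^2) * X^2 : PowerSeries ℚ) ≠ 0 := by
    rintro h; rw [h, mul_zero] at h4; exact zero_ne_one h4
  have key : ((1 - C q * X) * ((1 - C (q^2) * X) * ((1 - C q * X^2) * (1 - C (q^2) * X^2)))) * ((1 - C (q^2) * X) * (1 - C q * X^2)) ≠ (0 : PowerSeries ℚ) := by
    simp only [ne_eq, mul_eq_zero, not_or]; tauto
  apply mul_left_cancel₀ key
  simp only [map_pow, map_mul, pow_two] at *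
  generalize (C q : PowerSeries ℚ) = c at *
  generalize (X : PowerSeries ℚ) = x at *
  generalize derivative ℚ R = R' at *
  have hu : ∃ u1 u2 u3 u4, u1 = 1 - c * x ∧ u2 = 1 - c * c * x ∧ u3 = 1 - c * (x * x) ∧ u4 = 1 - c * c * (x * x) := ⟨_, _, _, _, rfl, rfl, rfl, rfl⟩
  obtain ⟨u1, u2, u3, u4, hu1, hu2, hu3, hu4⟩ := hu
  have hM : ∃ M D', M = u1*u3*u4 - u2*u3*u4 - 2 * (u1*u2*u3 - u1*u2*u4) ∧ D' = u2 * (-(2*c*x)) + u3 * (-(c*c)) := ⟨_, _, rfl, rfl⟩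
  obtain ⟨M, D', hM, hD'⟩ := hM
  rw [← hu1] at h1 hR hd ⊢
  rw [← hu2] at h2 hR hd ⊢
  rw [← hu3] at h3 hR hd ⊢
  rw [← hu4] at h4 hR hd ⊢
  have hp : x * (u2 * u3) * (u1 * (-(2*c*c*x)) + u4 * (-c)) - x * (u1 * u4) * D' = M := by
    rw [hM, hD', hu1, hu2, hu3, hu4]; ring
  have hd2 : R * D' + u2 * u3 * R' = u1 * (-(2*c*c*x)) + u4 * (-c) := by
    rw [hD']; linear_combination hd
  rw [hM] at hp
  linear_combination (u1*u2*u3*u4*x) * hd2 - (u2*u3*R)*(u1*u3*u4*h2 - u2*u3*u4*h1 - 2*(u1*u2*u3*h4-u1*u2*u4*h3)) - (x*u1*u4*D' + (u1*u3*u4 - u2*u3*u4 - 2 * (u1*u2*u3 - u1*u2*u4))) * hR + u1*u4*hp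

open Finset PowerSeries in
theorem mkA (a : ℚ) : (PowerSeries.mk fun n => a ^ n) * (1 - C a * X) = 1 := by
  ext n
  rw [mul_sub, mul_one, mul_comm (C a), ← mul_assoc, map_sub]
  rcases n with _ | n
  · simp 
  · rw [coeff_mul_C, coeff_succ_mul_X]; simp [coeff_one, pow_succ]

open Finset PowerSeries in
theorem mkB (a : ℚ) : (PowerSeries.mk fun n => if Even n then a ^ (n / 2) else 0) * (1 - C a * X ^ 2) = 1 := by
  ext n
  rw [mul_sub, mul_one, mul_comm (C a), ← mul_assoc, map_sub, coeff_mul_C, coeff_mul_X_pow']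
  rcases n with _ | _ | n
  · simp 
  · simp [coeff_one]
  · have : (n + 1 + 1) / 2 = n / 2 + 1 := by omega
    simp [coeff_one, Nat.even_add_one, pow_succ, this]

open Finset PowerSeries in
theorem closedR (q : ℚ) (hq : 0 < q) (A2 B1 R : PowerSeries ℚ)
  (h2 : A2 * (1 - C (q^2) * X) = 1)
  (h3 : B1 * (1 - C q * X^2) = 1)
  (hR : C (1 + q + q^2) * R = C (1+q+q^2) + C (q^2-1) * A2 - C (q^2-1) * B1 + C ((q-1)*q) * X * B1) :
   R * ((1 - C (q^2) * X) * (1 - C q * X^2)) = (1 - C q * X) * (1 - C (q^2) * X^2) := by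
  have key : (C (1 + q + q^2) : PowerSeries ℚ) ≠ 0 := by
    rw [ne_eq, map_eq_zero_iff _ C_injective]; positivity
  apply mul_left_cancel₀ key
  simp only [map_pow, map_mul, map_add, map_sub, map_one] at *
  generalize (C q : PowerSeries ℚ) = c at *
  generalize (X : PowerSeries ℚ) = x at *
  linear_combination (1-c^2*x)*(1-c*x^2) * hR + (c^2-1)*(1-c*x^2)*h2 + (-(c^2-1) + (c-1)*c*x)*(1-c^2*x)*h3

open Finset

/-- recurrence for a sequence -/
theorem uniq (n0 : ℕ) (a r c d : ℕ → ℚ) (h0 : a 0 = r 0)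
   (hd0 : d 0 = 0) (hc0 : c 0 = 0) (hcd : ∀ m ≤ n0, c m = d m)
   (ha : ∀ n, n * a n = ∑ p ∈ antidiagonal n, a p.1 * c p.2)
   (hr : ∀ n, n * r n = ∑ p ∈ antidiagonal n, r p.1 * d p.2) : ∀ n ≤ n0, a n = r n := by
  intro n
  induction n using Nat.strong_induction_on with
  | _ n ih =>
    intro hn
    rcases Nat.eq_zero_or_pos n with rfl | hpos
    · exact h0
    have : (n:ℚ) * a n = n * r n := by
      rw [ha, hr]
      apply Finset.sum_congr rfl
      rintro ⟨i, j⟩ hij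
      simp only [HasAntidiagonal.mem_antidiagonal] at hij
      rcases Nat.eq_zero_or_pos j with rfl | hj
      · simp [hd0, hc0]
      · simp only
        rw [ih i (by omega) (by omega), hcd j (by omega)]
    exact mul_left_cancel₀ (by positivity) this

section comb
variable {Y : Type*} [Fintype Y] [DecidableEq Y] (σ : Equiv.Perm Y)

def StabS (S : Finset Y) : Prop := ∀ x, σ x ∈ S ↔ x ∈ S

open Classical in
noncomputable def cnt (n : ℕ) : ℚ := #{S : Finset Y | StabS σ S ∧ #S = n}
open Classical in
noncomputable def cntx (x : Y) (n : ℕ) : ℚ := #{S : Finset Y | (StabS σ S ∧ #S = n) ∧ x ∈ S}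

noncomputable def per (x : Y) : ℕ := Function.minimalPeriod σ x

def wt (d m : ℕ) : ℚ := if d ∣ m ∧ m ≠ 0 then -(-1) ^ (m / d) else 0

noncomputable def orb (x : Y) : Finset Y := (range (per σ x)).image (fun i => σ^[i] x)

theorem per_pos (x : Y) : 0 < per σ x := by
  apply Function.minimalPeriod_pos_of_mem_periodicPts
  exact (Function.Injective.mem_periodicPts σ.injective x)

theorem card_orb (x : Y) : #(orb σ x) = per σ x := by
  rw [orb, card_image_of_injOn, card_range]
  intro i hi j hj h
  simp only [coe_range, Set.mem_Iio] at hi hj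
  exact Function.iterate_injOn_Iio_minimalPeriod hi hj h

theorem mem_orb (x y : Y) : y ∈ orb σ x ↔ ∃ i, σ^[i] x = y := by
  simp only [orb, mem_image, mem_range]
  constructor
  · rintro ⟨i, -, h⟩; exact ⟨i, h⟩
  · rintro ⟨i, h⟩
    refine ⟨i % per σ x, Nat.mod_lt _ (per_pos σ x), ?_⟩
    rw [← h]; exact Function.iterate_mod_minimalPeriod_eq

theorem stab_orb (x : Y) : StabS σ (orb σ x) := by
  have h1 : ∀ y, y ∈ orb σ x → σ y ∈ orb σ x := by
    intro y
    rw [mem_orb, mem_orb]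
    rintro ⟨i, rfl⟩
    exact ⟨i+1, by rw [Function.iterate_succ_apply']⟩
  have h2 : (orb σ x).image σ = orb σ x := by
    apply Finset.eq_of_subset_of_card_le
    · intro y hy
      obtain ⟨z, hz, rfl⟩ := mem_image.1 hy
      exact h1 z hz
    · rw [card_image_of_injective _ σ.injective]
  intro y
  refine ⟨fun h => ?_, h1 y⟩
  rw [← h2] at h
  obtain ⟨z, hz, h⟩ := mem_image.1 h
  rwa [← σ.injective h]

theorem stab_iff (S : Finset Y) (hS : StabS σ S) (x y : Y) (hy : y ∈ orb σ x) : y ∈ S ↔ x ∈ S := by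
  rw [mem_orb] at hy
  obtain ⟨i, rfl⟩ := hy
  induction i with
  | zero => rfl
  | succ i ih => rw [Function.iterate_succ_apply', hS, ih]

theorem self_mem_orb (x : Y) : x ∈ orb σ x := (mem_orb σ x x).2 ⟨0, rfl⟩

theorem cntx_add (x : Y) (n : ℕ) : cntx σ x (n + per σ x) + cntx σ x n = cnt σ n := by
  classical
  have h : cntx σ x (n + per σ x) = #{S : Finset Y | (StabS σ S ∧ #S = n) ∧ ¬ x ∈ S} := by
    unfold cntx
    norm_cast
    apply Finset.card_bij' (fun S _ => S \ orb σ x) (fun S _ => S ∪ orb σ x)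
    · intro S hS
      simp only [mem_filter, mem_univ, true_and] at hS ⊢
      obtain ⟨⟨hS, hc⟩, hx⟩ := hS
      have hsub : orb σ x ⊆ S := fun y hy => (stab_iff σ S hS x y hy).2 hx
      refine ⟨⟨?_, ?_⟩, ?_⟩
      · intro y; simp only [mem_sdiff]; rw [hS y, stab_orb σ x y]
      · rw [card_sdiff_of_subset hsub, card_orb]; omega
      · simp [self_mem_orb]
    · intro S hS
      simp only [mem_filter, mem_univ, true_and] at hS ⊢
      obtain ⟨⟨hS, hc⟩, hx⟩ := hS
      have hdis : Disjoint S (orb σ x) := by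
        rw [Finset.disjoint_left]
        intro y hy hy'
        exact hx ((stab_iff σ S hS x y hy').1 hy)
      refine ⟨⟨?_, ?_⟩, ?_⟩
      · intro y; simp only [mem_union]; rw [hS y, stab_orb σ x y]
      · rw [card_union_of_disjoint hdis, card_orb, hc]
      · simp [self_mem_orb]
    · intro S hS
      simp only [mem_filter, mem_univ, true_and] at hS ⊢
      obtain ⟨⟨hS, hc⟩, hx⟩ := hS
      have hsub : orb σ x ⊆ S := fun y hy => (stab_iff σ S hS x y hy).2 hx
      exact sdiff_union_of_subset hsub
    · intro S hS
      simp only [mem_filter, mem_univ, true_and] at hS ⊢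
      obtain ⟨⟨hS, hc⟩, hx⟩ := hS
      have hdis : Disjoint S (orb σ x) := by
        rw [Finset.disjoint_left]
        intro y hy hy'
        exact hx ((stab_iff σ S hS x y hy').1 hy)
      exact union_sdiff_cancel_right hdis
  rw [h, cntx, cnt]
  norm_cast
  rw [add_comm, ← filter_filter (fun S => StabS σ S ∧ #S = n), ← filter_filter (fun S => StabS σ S ∧ #S = n)]
  rw [Finset.card_filter_add_card_filter_not]

theorem cntx_lt (x : Y) (n : ℕ) (h : n < per σ x) : cntx σ x n = 0 := by
  classical
  unfold cntx
  norm_cast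
  rw [card_eq_zero, filter_eq_empty_iff]
  rintro S - ⟨⟨hS, hc⟩, hx⟩
  have hsub : orb σ x ⊆ S := fun y hy => (stab_iff σ S hS x y hy).2 hx
  have := card_le_card hsub
  rw [card_orb] at this; omega

open PowerSeries in
theorem wt_ser (d : ℕ) (hd : 0 < d) : PowerSeries.mk (wt d) * (1 + X ^ d) = X ^ d := by
  ext n
  rw [mul_add, mul_one, map_add, coeff_mul_X_pow', coeff_X_pow]
  simp only [coeff_mk, wt]
  by_cases hdn : d ∣ n
  · obtain ⟨j, rfl⟩ := hdn
    rcases j with _ | _ | j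
    · simp [hd.ne', hd.ne]
    · simp [hd.ne', hd]
    · have e : d * (j + 1 + 1) - d = d * (j + 1) := by
        rw [mul_add d (j+1)]; simp
      have e1 : d ≤ d * (j + 1 + 1) := Nat.le_mul_of_pos_right _ (by omega)
      have e2 : d * (j + 1 + 1) ≠ d := by
        intro h
        have := Nat.eq_of_mul_eq_mul_left hd (h.trans (mul_one d).symm)
        omega
      rw [e, Nat.mul_div_cancel_left _ hd, Nat.mul_div_cancel_left _ hd]
      simp [hd.ne', e1, e2, pow_succ]
  · have h1 : d ≤ n → ¬ d ∣ n - d := by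
      intro h h'
      apply hdn
      have := dvd_add h' (dvd_refl d)
      rwa [Nat.sub_add_cancel h] at this
    have h2 : n ≠ d := by rintro rfl; exact hdn dvd_rfl
    by_cases h : d ≤ n
    · simp [hdn, h1 h, h2]
    · simp [hdn, h, h2]

open PowerSeries in
theorem cntx_ser (x : Y) : PowerSeries.mk (cntx σ x) = PowerSeries.mk (cnt σ) * PowerSeries.mk (wt (per σ x)) := by
  have h : PowerSeries.mk (cntx σ x) * (1 + X ^ per σ x) = PowerSeries.mk (cnt σ) * X ^ per σ x := by
    ext n
    rw [mul_add, mul_one, map_add, coeff_mul_X_pow', coeff_mul_X_pow']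
    simp only [coeff_mk]
    split_ifs with h
    · rw [← cntx_add σ x (n - per σ x), Nat.sub_add_cancel h]
    · rw [cntx_lt σ x n (by omega)]; simp
  have hne : (1 + X ^ per σ x : PowerSeries ℚ) ≠ 0 := by
    intro h0
    have := congrArg (coeff 0) h0
    simp [coeff_X_pow, (per_pos σ x).ne] at this
    simp [(per_pos σ x).ne'] at this
  apply mul_right_cancel₀ hne
  rw [h, mul_assoc, wt_ser _ (per_pos σ x)]

theorem sum_cntx (n : ℕ) : ∑ x, cntx σ x n = n * cnt σ n := by
  classical
  unfold cntx cnt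
  simp only [← filter_filter (fun S => StabS σ S ∧ #S = n)]
  norm_cast
  simp only [card_filter _ (filter _ _)]
  rw [sum_comm]
  rw [sum_congr rfl (g := fun _ => n)]
  · simp [mul_comm]
  · intro S hS
    simp at hS
    simp [hS.2]

theorem cnt_rec (n : ℕ) : n * cnt σ n = ∑ p ∈ antidiagonal n, cnt σ p.1 * ∑ x, wt (per σ x) p.2 := by
  rw [← sum_cntx]
  simp only [mul_sum]
  rw [sum_comm]
  apply sum_congr rfl
  intro x _
  have := congrArg (PowerSeries.coeff n) (cntx_ser σ x)
  rw [PowerSeries.coeff_mul] at this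
  simpa using this

theorem cnt_zero : cnt σ 0 = 1 := by
  classical
  unfold cnt
  norm_cast
  rw [card_eq_one]
  refine ⟨∅, ?_⟩
  ext S
  simp only [mem_filter, mem_univ, true_and, card_eq_zero, mem_singleton]
  constructor
  · exact fun h => h.2
  · rintro rfl; exact ⟨fun x => by simp, rfl⟩

theorem sum_wt (m : ℕ) (hm : m ≠ 0) : ∑ x, wt (per σ x) m = #{x | σ^[m] x = x} - 2 * (if Even m then (#{x | σ^[m/2] x = x} : ℚ) else 0) := by
  have h : ∀ x m, σ^[m] x = x ↔ per σ x ∣ m := fun x m => Function.isPeriodicPt_iff_minimalPeriod_dvd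
  simp only [h, card_filter, Nat.cast_sum]
  have e : (if Even m then (∑ i, ((if per σ i ∣ m / 2 then 1 else 0 : ℕ) : ℚ)) else 0) = ∑ i, if Even m ∧ per σ i ∣ m / 2 then (1:ℚ) else 0 := by
    split_ifs with h <;> simp [h]
  rw [e, mul_sum, ← sum_sub_distrib]
  apply sum_congr rfl
  intro x _
  have hp := per_pos σ x
  generalize per σ x = d at *
  unfold wt
  by_cases hd : d ∣ m
  · obtain ⟨j, rfl⟩ := hd
    rw [Nat.mul_div_cancel_left _ hp]
    rcases Nat.even_or_odd j with hj | hj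
    · obtain ⟨i, rfl⟩ := hj
      have h1 : d * (i + i) / 2 = d * i := by
        rw [← mul_two, ← mul_assoc]; simp
      rw [h1]
      simp [hm]
      norm_num
    · have : ¬ (Even (d * j) ∧ d ∣ d * j / 2) := by
        rintro ⟨⟨t, ht⟩, h2⟩
        rw [ht, ← two_mul, Nat.mul_div_cancel_left _ (by norm_num)] at h2
        obtain ⟨s, rfl⟩ := h2
        have : d * j = d * (s + s) := by rw [ht]; ring
        have := Nat.eq_of_mul_eq_mul_left hp this
        rw [← Nat.not_even_iff_odd] at hj
        exact hj ⟨s, this⟩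
      simp [this, hm, hj]
  · have : ¬ (Even m ∧ d ∣ m / 2) := by
      rintro ⟨⟨t, rfl⟩, h2⟩
      rw [← two_mul, Nat.mul_div_cancel_left _ (by norm_num)] at h2
      exact hd (dvd_add h2 h2)
    simp [hd, this]
end comb

open PowerSeries in
noncomputable def Rser (q : ℚ) : PowerSeries ℚ :=
  C ((1 + q + q^2)⁻¹) * (C (1+q+q^2) + C (q^2-1) * (PowerSeries.mk fun n => (q^2) ^ n)
    - C (q^2-1) * (PowerSeries.mk fun n => if Even n then q ^ (n / 2) else 0)
    + C ((q-1)*q) * X * (PowerSeries.mk fun n => if Even n then q ^ (n / 2) else 0))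

open PowerSeries in
theorem Rser_rec (q : ℚ) (hq : 0 < q) (n : ℕ) : n * coeff n (Rser q) =
    ∑ p ∈ antidiagonal n, coeff p.1 (Rser q) * (((q^2)^p.2 - q^p.2) - 2 * (if Even p.2 then (q^2)^(p.2/2) - q^(p.2/2) else 0)) := by
  have hne : 1 + q + q^2 ≠ 0 := by positivity
  have h := algA q _ _ _ _ (Rser q) (mkA q) (mkA (q^2)) (mkB q) (mkB (q^2)) (closedR q hq _ _ _ (mkA (q^2)) (mkB q) (by
    rw [Rser, ← mul_assoc, ← map_mul, mul_inv_cancel₀ hne, map_one, one_mul]))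
  have h := congrArg (coeff n) h
  have e : coeff n (X * derivative ℚ (Rser q)) = n * coeff n (Rser q) := by
    rcases n with _ | n
    · simp
    · rw [coeff_succ_X_mul, coeff_derivative]; push_cast; ring
  rw [e, coeff_mul] at h
  rw [h]
  apply sum_congr rfl
  intro p _
  have : (2 : PowerSeries ℚ) = C 2 := (map_ofNat C 2).symm
  rw [this]
  simp only [map_sub, coeff_mk, coeff_C_mul]
  split_ifs <;> ring

open PowerSeries in
theorem Rser_zero (q : ℚ) (hq : 0 < q) : coeff 0 (Rser q) = 1 := by
  have hne : 1 + q + q^2 ≠ 0 := by positivity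
  simp [Rser, hne]

open PowerSeries in
theorem Rser_even (q : ℚ) (n : ℕ) (hn : 0 < n) (h : Even n) : coeff n (Rser q) =
   ((q ^ 2 - 1) / (q ^ 2 + q + 1)) * (q ^ (2 * n) - q ^ (n / 2)) := by
  obtain ⟨m, rfl⟩ : ∃ m, n = m + 1 := ⟨n - 1, by omega⟩
  have h' : ¬ Even m := by rwa [Nat.even_add_one] at h
  rw [Rser, coeff_C_mul, map_add, map_sub, map_add, mul_assoc, coeff_C_mul, coeff_C_mul, coeff_C_mul, coeff_succ_X_mul, coeff_C]
  simp only [coeff_mk, h, h', if_true, if_false]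
  rw [if_neg (by omega)]
  ring

open PowerSeries in
theorem Rser_odd (q : ℚ) (n : ℕ) (hn : 0 < n) (h : Odd n) : coeff n (Rser q) =
   ((q - 1) / (q ^ 2 + q + 1)) * ((q + 1) * q ^ (2 * n) + q ^ ((n + 1) / 2)) := by
  obtain ⟨m, rfl⟩ : ∃ m, n = m + 1 := ⟨n - 1, by omega⟩
  have h1 : ¬ Even (m + 1) := Nat.not_even_iff_odd.2 h
  have h' : Even m := by rwa [Nat.even_add_one, not_not] at h1
  rw [Rser, coeff_C_mul, map_add, map_sub, map_add, mul_assoc, coeff_C_mul, coeff_C_mul, coeff_C_mul, coeff_succ_X_mul, coeff_C]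
  simp only [coeff_mk, h1, h', if_true, if_false]
  rw [if_neg (by omega)]
  have : (m + 1 + 1) / 2 = m / 2 + 1 := by omega
  rw [this]
  ring

theorem cnt_eq {Y : Type*} [Fintype Y] [DecidableEq Y] (σ : Equiv.Perm Y) (q : ℚ) (hq : 0 < q) (n : ℕ)
    (h : ∀ m ≤ n, m ≠ 0 → (#{x | σ^[m] x = x} : ℚ) = (q^2)^m - q^m) :
    cnt σ n = PowerSeries.coeff n (Rser q) := by
  refine uniq n (cnt σ) (fun n => PowerSeries.coeff n (Rser q)) (fun m => ∑ x, wt (per σ x) m)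
    (fun m => ((q^2)^m - q^m) - 2 * (if Even m then (q^2)^(m/2) - q^(m/2) else 0)) ?_ ?_ ?_ ?_
    (cnt_rec σ) (Rser_rec q hq) n le_rfl
  · rw [cnt_zero, Rser_zero q hq]
  · simp
  · simp [wt]
  · intro m hm
    rcases Nat.eq_zero_or_pos m with rfl | hp
    · simp [wt]
    · rw [sum_wt σ m hp.ne', h m hm hp.ne']
      congr 2
      split_ifs with he
      · rw [h (m/2) (by omega) (by obtain ⟨t, rfl⟩ := he; omega)]
      · rfl

/-- transfer -/
theorem nSet_eq {X : Type*} (f : X → X) (hf : Function.Injective f) (A : Set X) (hA : ∀ x, x ∈ A → f x ∈ A)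
    (n : ℕ) (q : ℚ) (hq : 0 < q)
    (hfin : ∀ m, m ≠ 0 → {x | x ∈ A ∧ f^[m] x = x}.Finite)
    (hfix : ∀ m, m ≠ 0 → ({x | x ∈ A ∧ f^[m] x = x}.ncard : ℚ) = (q^2)^m - q^m) :
    (nSetCount f A n : ℚ) = PowerSeries.coeff n (Rser q) := by
  classical
  let Ys : Set X := {x | x ∈ A ∧ f^[n.factorial] x = x}
  have hYs : Ys.Finite := hfin _ (Nat.factorial_ne_zero n)
  let _ : Fintype Ys := hYs.fintype
  have hmaps : ∀ x, x ∈ Ys → f x ∈ Ys := by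
    rintro x ⟨h1, h2⟩
    refine ⟨hA x h1, ?_⟩
    rw [← Function.iterate_succ_apply, Function.iterate_succ_apply', h2]
  let g : Ys → Ys := fun x => ⟨f x, hmaps x x.2⟩
  have hg : Function.Injective g := by
    intro x y h
    exact Subtype.ext (hf (congrArg Subtype.val h))
  let σ : Equiv.Perm Ys := Equiv.ofBijective g (Finite.injective_iff_bijective.1 hg)
  have hσ : ∀ x : Ys, ((σ x : Ys) : X) = f x := fun x => rfl
  have hit : ∀ m (x : Ys), ((σ^[m] x : Ys) : X) = f^[m] x := by
    intro m
    induction m with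
    | zero => intro x; rfl
    | succ m ih => intro x; rw [Function.iterate_succ_apply', Function.iterate_succ_apply', hσ, ih]
  rw [← cnt_eq σ q hq n]
  · unfold cnt nSetCount
    rw [← Set.ncard_coe_finset]
    rw [Nat.cast_inj]
    symm
    apply Set.ncard_congr (fun (S : Finset Ys) _ => Subtype.val '' (S : Set Ys))
    · intro S hS
      simp only [coe_filter, mem_univ, true_and, Set.mem_ofPred_eq] at hS
      obtain ⟨hS, hc⟩ := hS
      refine ⟨?_, S.finite_toSet.image _, ?_, ?_⟩
      · rintro _ ⟨x, -, rfl⟩; exact x.2.1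
      · rw [Set.ncard_image_of_injective _ Subtype.val_injective, Set.ncard_coe_finset, hc]
      · ext y
        constructor
        · rintro ⟨_, ⟨x, hx, rfl⟩, rfl⟩
          exact ⟨σ x, (hS x).2 hx, rfl⟩
        · rintro ⟨x, hx, rfl⟩
          refine ⟨_, ⟨σ.symm x, ?_, rfl⟩, ?_⟩
          · have := hS (σ.symm x)
            rw [Equiv.apply_symm_apply] at this
            exact this.1 hx
          · rw [← hσ, Equiv.apply_symm_apply]
    · intro S T _ _ h
      exact Finset.coe_injective (Set.image_injective.2 Subtype.val_injective h)
    · rintro S ⟨hSA, hSf, hSc, hSs⟩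
      have hm : ∀ x : S, f x ∈ S := fun x => hSs.subset (Set.mem_image_of_mem f x.2)
      let _ : Fintype S := hSf.fintype
      let s : S → S := fun x => ⟨f x, hm x⟩
      have hs : Function.Injective s := by
        intro x y h
        exact Subtype.ext (hf (congrArg Subtype.val h))
      let τ : Equiv.Perm S := Equiv.ofBijective s (Finite.injective_iff_bijective.1 hs)
      have hitτ : ∀ m (x : S), (((τ^m) x : S) : X) = f^[m] x := by
        intro m
        induction m with
        | zero => intro x; rfl
        | succ m ih => intro x; rw [Function.iterate_succ_apply', pow_succ', Equiv.Perm.mul_apply, ← ih]; rfl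
      have hpow : τ ^ n.factorial = 1 := by
        have := pow_card_eq_one (x := τ)
        rwa [Fintype.card_perm, ← Nat.card_eq_fintype_card, Nat.card_coe_set_eq, hSc] at this
      have hSY : S ⊆ Ys := by
        intro x hx
        refine ⟨hSA hx, ?_⟩
        rw [← hitτ _ ⟨x, hx⟩, hpow]; rfl
      have him : Subtype.val '' (((univ.filter fun y : Ys => (y : X) ∈ S) : Finset Ys) : Set Ys) = S := by
        ext x
        simp only [coe_filter, mem_univ, true_and, Set.mem_image, Set.mem_ofPred_eq]
        constructor
        · rintro ⟨y, hy, rfl⟩; exact hy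
        · intro hx; exact ⟨⟨x, hSY hx⟩, hx, rfl⟩
      refine ⟨univ.filter fun y => (y : X) ∈ S, ?_, him⟩
      simp only [coe_filter, mem_univ, true_and, Set.mem_ofPred_eq]
      constructor
      · intro x
        simp only [mem_filter, mem_univ, true_and, hσ]
        constructor
        · intro h
          rw [← hSs] at h
          obtain ⟨y, hy, h⟩ := h
          rwa [← hf h]
        · intro h; exact hm ⟨x, h⟩
      · rw [← hSc, ← Set.ncard_coe_finset, ← Set.ncard_image_of_injective _ Subtype.val_injective, him]
  · intro m hm hm0
    rw [← hfix m hm0, ← Set.ncard_coe_finset]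
    rw [Nat.cast_inj]
    rw [← Set.ncard_image_of_injective _ Subtype.val_injective]
    congr 1
    ext x
    simp only [coe_filter, mem_univ, true_and, Set.mem_image, Set.mem_ofPred_eq]
    constructor
    · rintro ⟨y, hy, rfl⟩
      refine ⟨y.2.1, ?_⟩
      rw [← hit, hy]
    · rintro ⟨hx, h⟩
      have hY : x ∈ Ys := by
        refine ⟨hx, ?_⟩
        have h1 : Function.IsPeriodicPt f m x := h
        exact h1.trans_dvd (Nat.dvd_factorial (Nat.pos_of_ne_zero hm0) hm)
      refine ⟨⟨x, hY⟩, Subtype.ext ?_, rfl⟩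
      rw [hit]; exact h

section field
variable (k : Type*) [Field k] [Fintype k]

theorem frob_iter (m : ℕ) (v : Fin 2 → AlgebraicClosure k) (i : Fin 2) :
    (afFrob k 2)^[m] v i = (v i) ^ (Fintype.card k ^ m) := by
  induction m with
  | zero => simp
  | succ m ih => rw [Function.iterate_succ_apply', afFrob, ih, ← pow_mul, pow_succ]

theorem frob_add (m : ℕ) (x y : AlgebraicClosure k) : (x + y) ^ (Fintype.card k ^ m) = x ^ (Fintype.card k ^ m) + y ^ (Fintype.card k ^ m) := by
  obtain ⟨p, hp⟩ := CharP.exists k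
  obtain ⟨n, hpp, hn⟩ := FiniteField.card k p
  have : Fact p.Prime := ⟨hpp⟩
  have : CharP (AlgebraicClosure k) p := charP_of_injective_algebraMap (algebraMap k _).injective p
  rw [hn, ← pow_mul, add_pow_char_pow]

theorem frob_inj : Function.Injective fun x : AlgebraicClosure k => x ^ Fintype.card k := by
  intro x y h
  have h1 := frob_add k 1 (x - y) y
  simp only [pow_one, sub_add_cancel] at h1 h
  rw [h] at h1
  have : (x - y) ^ Fintype.card k = 0 := by linear_combination -h1
  exact sub_eq_zero.1 (pow_eq_zero_iff (Fintype.card_ne_zero) |>.1 this)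

theorem frob_base (m : ℕ) (a : k) : (algebraMap k (AlgebraicClosure k) a) ^ (Fintype.card k ^ m) = algebraMap k _ a := by
  rw [← map_pow, FiniteField.pow_card_pow]

open Polynomial in
theorem fix_card (m : ℕ) (hm : m ≠ 0) : {x : AlgebraicClosure k | x ^ (Fintype.card k ^ m) = x}.ncard = Fintype.card k ^ m := by
  classical
  obtain ⟨p, hp⟩ := CharP.exists k
  obtain ⟨n, hpp, hn⟩ := FiniteField.card k p
  have : Fact p.Prime := ⟨hpp⟩
  have : CharP (AlgebraicClosure k) p := charP_of_injective_algebraMap (algebraMap k _).injective p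
  have hq1 : 1 < Fintype.card k ^ m := Nat.one_lt_pow hm Fintype.one_lt_card
  have hsep : (X ^ (Fintype.card k ^ m) - X : (AlgebraicClosure k)[X]).Separable := by
    apply galois_poly_separable p
    rw [hn, ← pow_mul]
    exact dvd_pow_self p (by positivity)
  have hdeg := FiniteField.X_pow_card_sub_X_natDegree_eq (AlgebraicClosure k) hq1
  have hne := FiniteField.X_pow_card_sub_X_ne_zero (AlgebraicClosure k) hq1
  have hc := Polynomial.card_rootSet_eq_natDegree hsep (IsAlgClosed.splits (X ^ (Fintype.card k ^ m) - X : (AlgebraicClosure k)[X]) |>.map (algebraMap _ (AlgebraicClosure k)))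
  rw [hdeg, ← Nat.card_eq_fintype_card, Nat.card_coe_set_eq] at hc
  refine Eq.trans ?_ hc
  congr 1
  ext x
  rw [Polynomial.mem_rootSet_of_ne hne]
  simp [sub_eq_zero]

theorem fix_line (a b c : k) (hab : ¬(a = 0 ∧ b = 0)) (m : ℕ) (hm : m ≠ 0) :
   {v : Fin 2 → AlgebraicClosure k | (algebraMap k (AlgebraicClosure k) a * v 0 +
        algebraMap k (AlgebraicClosure k) b * v 1 =
          algebraMap k (AlgebraicClosure k) c) ∧ (afFrob k 2)^[m] v = v}.ncard = Fintype.card k ^ m := by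
  rw [← fix_card k m hm]
  have hinj : Function.Injective (algebraMap k (AlgebraicClosure k)) := (algebraMap k _).injective
  have hfa := frob_base k m a
  have hfb := frob_base k m b
  have hfc := frob_base k m c
  have hadd := frob_add k m
  have hneg : ∀ x y : AlgebraicClosure k, (x - y) ^ (Fintype.card k ^ m) = x ^ (Fintype.card k ^ m) - y ^ (Fintype.card k ^ m) := by
    intro x y
    have := hadd (x - y) y
    rw [sub_add_cancel] at this
    rw [this]; ring
  have hiff : ∀ v : Fin 2 → AlgebraicClosure k, (afFrob k 2)^[m] v = v ↔ v 0 ^ (Fintype.card k ^ m) = v 0 ∧ v 1 ^ (Fintype.card k ^ m) = v 1 := by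
    intro v
    rw [funext_iff, Fin.forall_fin_two, frob_iter, frob_iter]
  simp only [hiff]
  by_cases ha : a = 0
  · have hb : algebraMap k (AlgebraicClosure k) b ≠ 0 := by
      rw [ne_eq, map_eq_zero_iff _ hinj]; exact fun h => hab ⟨ha, h⟩
    generalize algebraMap k (AlgebraicClosure k) a = a at *
    generalize algebraMap k (AlgebraicClosure k) b = b at *
    generalize algebraMap k (AlgebraicClosure k) c = c at *
    apply Set.ncard_congr (fun v _ => v 0)
    · rintro v ⟨-, h, -⟩; exact h
    · rintro v w ⟨h1, -⟩ ⟨h2, -⟩ h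
      rw [h, ← h2] at h1
      have := mul_left_cancel₀ hb (add_left_cancel h1)
      ext i; fin_cases i
      · exact h
      · exact this
    · intro x hx
      refine ⟨![x, (c - a * x) / b], ⟨?_, hx, ?_⟩, rfl⟩
      · simp; field_simp; ring
      · simp only [Matrix.cons_val_one, Matrix.cons_val_zero]
        rw [div_pow, hneg, mul_pow, hfa, hfb, hfc, hx]
  · have ha : algebraMap k (AlgebraicClosure k) a ≠ 0 := by
      rwa [ne_eq, map_eq_zero_iff _ hinj]
    generalize algebraMap k (AlgebraicClosure k) a = a at *
    generalize algebraMap k (AlgebraicClosure k) b = b at *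
    generalize algebraMap k (AlgebraicClosure k) c = c at *
    apply Set.ncard_congr (fun v _ => v 1)
    · rintro v ⟨-, -, h⟩; exact h
    · rintro v w ⟨h1, -⟩ ⟨h2, -⟩ h
      rw [h, ← h2] at h1
      have := mul_left_cancel₀ ha (add_right_cancel h1)
      ext i; fin_cases i
      · exact this
      · exact h
    · intro x hx
      refine ⟨![(c - b * x) / a, x], ⟨?_, ?_, hx⟩, rfl⟩
      · simp; field_simp; ring
      · simp only [Matrix.cons_val_zero]
        rw [div_pow, hneg, mul_pow, hfa, hfb, hfc, hx]

theorem fix_plane (m : ℕ) (hm : m ≠ 0) :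
   {v : Fin 2 → AlgebraicClosure k | (afFrob k 2)^[m] v = v}.ncard = (Fintype.card k ^ m) ^ 2 := by
  have h := fix_card k m hm
  have e : {v : Fin 2 → AlgebraicClosure k | (afFrob k 2)^[m] v = v}
    = (finTwoArrowEquiv _) ⁻¹' ({x : AlgebraicClosure k | x ^ (Fintype.card k ^ m) = x} ×ˢ {x : AlgebraicClosure k | x ^ (Fintype.card k ^ m) = x}) := by
    ext v
    simp [funext_iff, Fin.forall_fin_two, frob_iter]
  rw [e, Set.ncard_preimage_of_injective_subset_range (Equiv.injective _) (fun y _ => Equiv.surjective _ y), Set.ncard_prod, h, sq]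

end field

/-- Let `L ⊆ k̄²` be a line defined over `𝔽_q` (given by `ax + by = c` with
`a, b, c ∈ 𝔽_q`, `(a,b) ≠ (0,0)`).  For `n > 0`, the number of `n`-element
subsets `S ⊆ k̄² \ L` with `σ(S) = S` is
`((q²−1)/(q²+q+1))(q^{2n} − q^{n/2})` for `n` even, and
`((q−1)/(q²+q+1))((q+1)q^{2n} + q^{(n+1)/2})` for `n` odd. -/
theorem stmt3 (k : Type*) [Field k] [Fintype k] (q n : ℕ)
    (hq : Fintype.card k = q) (hn : 0 < n)
    (a b c : k) (hab : ¬(a = 0 ∧ b = 0))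
    (L : Set (Fin 2 → AlgebraicClosure k))
    (hL : L = {v : Fin 2 → AlgebraicClosure k |
      algebraMap k (AlgebraicClosure k) a * v 0 +
        algebraMap k (AlgebraicClosure k) b * v 1 =
          algebraMap k (AlgebraicClosure k) c}) :
    (Even n →
      (nSetCount (afFrob k 2) Lᶜ n : ℚ) =
        (((q : ℚ) ^ 2 - 1) / ((q : ℚ) ^ 2 + q + 1)) *
          ((q : ℚ) ^ (2 * n) - (q : ℚ) ^ (n / 2))) ∧
    (Odd n →
      (nSetCount (afFrob k 2) Lᶜ n : ℚ) =
        (((q : ℚ) - 1) / ((q : ℚ) ^ 2 + q + 1)) *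
          (((q : ℚ) + 1) * (q : ℚ) ^ (2 * n) + (q : ℚ) ^ ((n + 1) / 2))) := by
  have hq0 : 0 < q := hq ▸ Fintype.card_pos
  have hqQ : (0:ℚ) < q := by exact_mod_cast hq0
  have hall : ∀ m, m ≠ 0 → {v : Fin 2 → AlgebraicClosure k | (afFrob k 2)^[m] v = v}.Finite := by
    intro m hm
    apply Set.finite_of_ncard_ne_zero
    rw [fix_plane k m hm, hq]; positivity
  have hLL : ∀ v, v ∈ Lᶜ → afFrob k 2 v ∈ Lᶜ := by
    intro v hv h
    apply hv
    rw [hL] at h ⊢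
    simp only [Set.mem_ofPred_eq, afFrob] at h ⊢
    apply frob_inj k
    have h1 := frob_add k 1
    have h2 := frob_base k 1
    simp only [pow_one] at h1 h2 ⊢
    rw [h1, mul_pow, mul_pow, h2, h2, h2]
    exact h
  have hinj : Function.Injective (afFrob k 2) := by
    intro v w h
    ext i
    exact frob_inj k (congrFun h i)
  have key := nSet_eq (afFrob k 2) hinj Lᶜ hLL n (q : ℚ) hqQ
    (fun m hm => (hall m hm).subset fun v hv => hv.2) (by
      intro m hm
      have h1 := fix_plane k m hm
      have h2 := fix_line k a b c hab m hm
      have h3 := Set.ncard_sdiff_add_ncard_of_subset (s := {v | v ∈ L ∧ (afFrob k 2)^[m] v = v})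
        (t := {v | (afFrob k 2)^[m] v = v}) (fun v hv => hv.2) (hall m hm)
      have e1 : {v | (afFrob k 2)^[m] v = v} \ {v | v ∈ L ∧ (afFrob k 2)^[m] v = v} = {x | x ∈ Lᶜ ∧ (afFrob k 2)^[m] x = x} := by
        ext v; simp only [Set.mem_sdiff, Set.mem_ofPred_eq, Set.mem_compl_iff]; tauto
      have e2 : {v | v ∈ L ∧ (afFrob k 2)^[m] v = v}.ncard = q ^ m := by
        rw [hL, ← hq]; exact h2
      rw [e1, e2, h1, hq] at h3
      have h4 : (({x | x ∈ Lᶜ ∧ (afFrob k 2)^[m] x = x}.ncard : ℕ) : ℚ) + (q:ℚ) ^ m = ((q:ℚ) ^ m) ^ 2 := by exact_mod_cast h3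
      rw [← pow_mul, mul_comm 2 m, pow_mul, ← h4]; ring)
  rw [key]
  exact ⟨Rser_even _ n hn, Rser_odd _ n hn⟩
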